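/- Let E be a directed graph, let F⁰ ⊆ E⁰ be a set of vertices, and set T⁰ := E⁰ \ F⁰. Then the concatenation map (βⁱ)_{i≥1} ↦ β¹β²β³⋯ is a bijection from the set of infinite sequences (βⁱ)_{i≥1} of F-segments satisfying s_E(βⁱ) = r_E(βⁱ⁺¹) for all i ≥ 1 onto the set {x ∈ E^∞ : r_E(x) ∈ F⁰ and s_E(x_i) ∈ F⁰ for infinitely many i ≥ 1}. -/

import Mathlib

/-- A finite path of length ≥ 1 in a directed graph with vertex set `V`, edge set `E`
and range and source maps `r s : E → V`: a nonempty list of edges `μ₁μ₂⋯μₙ` with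
`s(μᵢ) = r(μᵢ₊₁)`. -/
structure GraphSeg (V E : Type*) (r s : E → V) where
  /-- the list of edges of the path -/
  edges : List E
  ne : edges ≠ []
  chain : edges.Chain' fun e f => s e = r f

namespace GraphSeg

variable {V E : Type*} {r s : E → V}

/-- The range `r_E(μ) = r_E(μ₁)` of a finite path. -/
def rng (p : GraphSeg V E r s) : V := r (p.edges.head p.ne)

/-- The source `s_E(μ) = s_E(μₙ)` of a finite path. -/
def src (p : GraphSeg V E r s) : V := s (p.edges.getLast p.ne)

end GraphSeg

/-- Given a set of vertices `F⁰` (with `T⁰ := E⁰ \ F⁰`), an `F`-segment is a finite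
path `β` of length ≥ 1 with `r_E(β) ∈ F⁰`, `s_E(β) ∈ F⁰` and `s_E(βᵢ) ∈ T⁰` for all
`1 ≤ i < |β|`. -/
def IsFSegment {V E : Type*} {r s : E → V} (F0 : Set V) (p : GraphSeg V E r s) :
    Prop :=
  p.rng ∈ F0 ∧ p.src ∈ F0 ∧
    ∀ (i : ℕ) (h : i + 1 < p.edges.length),
      s (p.edges.get ⟨i, Nat.lt_of_succ_lt h⟩) ∉ F0

/-- `IsConcat β x` says that the infinite edge sequence `x` is the concatenation
`β¹β²β³⋯` of the sequence of finite paths `β`: for every `k`, the edges of `β k`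
occupy the positions of `x` starting at `|β 0| + ⋯ + |β (k-1)|`. -/
def IsConcat {V E : Type*} {r s : E → V} (β : ℕ → GraphSeg V E r s) (x : ℕ → E) :
    Prop :=
  ∀ (k i : ℕ) (hi : i < (β k).edges.length),
    x ((∑ j ∈ Finset.range k, (β j).edges.length) + i) = (β k).edges.get ⟨i, hi⟩

theorem decomp_exists (L : ℕ → ℕ) (hL : ∀ k, 0 < L k) (n : ℕ) :
    ∃ k i, i < L k ∧ (∑ j ∈ Finset.range k, L j) + i = n := by
  induction n with
  | zero => exact ⟨0, 0, hL 0, by simp⟩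
  | succ n ih =>
    obtain ⟨k, i, hi, h⟩ := ih
    by_cases h1 : i + 1 < L k
    · exact ⟨k, i + 1, h1, by omega⟩
    · refine ⟨k + 1, 0, hL _, ?_⟩
      rw [Finset.sum_range_succ]
      omega

theorem offs_strictMono (L : ℕ → ℕ) (hL : ∀ k, 0 < L k) :
    StrictMono fun k => ∑ j ∈ Finset.range k, L j := by
  apply strictMono_nat_of_lt_succ
  intro k
  have := hL k
  simp only [Finset.sum_range_succ]
  omega

theorem decomp_lt (L : ℕ → ℕ) (hL : ∀ k, 0 < L k) {k i k' i' : ℕ} (hi : i < L k)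
    (hk : k < k') :
    (∑ j ∈ Finset.range k, L j) + i < (∑ j ∈ Finset.range k', L j) + i' := by
  have := (offs_strictMono L hL).monotone (show k + 1 ≤ k' from hk)
  simp only [Finset.sum_range_succ] at this
  omega

theorem decomp_unique (L : ℕ → ℕ) (hL : ∀ k, 0 < L k) {k i k' i' : ℕ} (hi : i < L k)
    (hi' : i' < L k')
    (h : (∑ j ∈ Finset.range k, L j) + i = (∑ j ∈ Finset.range k', L j) + i') :
    k = k' ∧ i = i' := by
  rcases lt_trichotomy k k' with hk | hk | hk
  · have := decomp_lt L hL (i' := i') hi hk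
    omega
  · subst hk
    exact ⟨rfl, by omega⟩
  · have := decomp_lt L hL (i' := i) hi' hk
    omega

section
variable {V E : Type*} {r s : E → V}

theorem GraphSeg.len_pos (p : GraphSeg V E r s) : 0 < p.edges.length :=
  List.length_pos_of_ne_nil p.ne

theorem exists_isConcat (β : ℕ → GraphSeg V E r s) : ∃ x, IsConcat β x := by
  have hL : ∀ k, 0 < (β k).edges.length := fun k => (β k).len_pos
  choose K I hI hKI using decomp_exists _ hL
  refine ⟨fun n => (β (K n)).edges.get ⟨I n, hI n⟩, ?_⟩
  intro k i hi
  obtain ⟨h1, h2⟩ := decomp_unique _ hL (hI _) hi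
    (hKI ((∑ j ∈ Finset.range k, (β j).edges.length) + i))
  simp only [List.get_eq_getElem]
  congr 1
  rw [h1]

theorem IsConcat.unique {β : ℕ → GraphSeg V E r s} {x y : ℕ → E} (hx : IsConcat β x)
    (hy : IsConcat β y) : x = y := by
  funext n
  obtain ⟨k, i, hi, rfl⟩ := decomp_exists _ (fun k => (β k).len_pos) n
  rw [hx k i hi, hy k i hi]

theorem IsConcat.first {β : ℕ → GraphSeg V E r s} {x : ℕ → E} (hx : IsConcat β x) (k : ℕ) :
    r (x (∑ j ∈ Finset.range k, (β j).edges.length)) = (β k).rng := by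
  have := hx k 0 (β k).len_pos
  simp only [add_zero] at this
  rw [this, GraphSeg.rng, List.head_eq_getElem]
  rfl

theorem IsConcat.last {β : ℕ → GraphSeg V E r s} {x : ℕ → E} (hx : IsConcat β x) {k i : ℕ}
    (hi : i + 1 = (β k).edges.length) :
    s (x ((∑ j ∈ Finset.range k, (β j).edges.length) + i)) = (β k).src := by
  rw [hx k i (by omega), GraphSeg.src, List.getLast_eq_getElem]
  simp only [List.get_eq_getElem]
  congr 2
  omega

theorem IsConcat.path {β : ℕ → GraphSeg V E r s} {x : ℕ → E} (hx : IsConcat β x)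
    (hβ : ∀ k, (β k).src = (β (k + 1)).rng) (n : ℕ) : s (x n) = r (x (n + 1)) := by
  obtain ⟨k, i, hi, rfl⟩ := decomp_exists _ (fun k => (β k).len_pos) n
  by_cases h : i + 1 < (β k).edges.length
  · rw [add_assoc, hx k i hi, hx k (i + 1) h]
    exact List.isChain_iff_getElem.1 (β k).chain i h
  · have h' : i + 1 = (β k).edges.length := by omega
    rw [hx.last h', hβ, ← hx.first, Finset.sum_range_succ, ← h', add_assoc]

theorem IsConcat.mem_iff {F0 : Set V} {β : ℕ → GraphSeg V E r s} {x : ℕ → E}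
    (hx : IsConcat β x) (hβ : ∀ k, IsFSegment F0 (β k)) (n : ℕ) :
    s (x n) ∈ F0 ↔ ∃ k, ∑ j ∈ Finset.range (k + 1), (β j).edges.length = n + 1 := by
  have hL : ∀ k, 0 < (β k).edges.length := fun k => (β k).len_pos
  obtain ⟨k, i, hi, rfl⟩ := decomp_exists _ hL n
  by_cases h : i + 1 < (β k).edges.length
  · rw [hx k i hi]
    refine iff_of_false ((hβ k).2.2 i h) ?_
    rintro ⟨k', hk'⟩
    have := (decomp_unique _ hL (hL (k' + 1)) h (by rw [hk']; omega)).2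
    omega
  · have h' : i + 1 = (β k).edges.length := by omega
    rw [hx.last h']
    refine iff_of_true (hβ k).2.1 ⟨k, ?_⟩
    rw [Finset.sum_range_succ]
    omega

theorem IsConcat.inj {F0 : Set V} {β γ : ℕ → GraphSeg V E r s} {x : ℕ → E}
    (hx : IsConcat β x) (hβ : ∀ k, IsFSegment F0 (β k))
    (hy : IsConcat γ x) (hγ : ∀ k, IsFSegment F0 (γ k)) : β = γ := by
  have h1 := (offs_strictMono _ fun k => (β k).len_pos)
  have h2 := (offs_strictMono _ fun k => (γ k).len_pos)
  have key : (fun k => ∑ j ∈ Finset.range (k + 1), (β j).edges.length) =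
      fun k => ∑ j ∈ Finset.range (k + 1), (γ j).edges.length := by
    refine (StrictMono.range_inj (fun a b h => h1 (Nat.succ_lt_succ h))
      (fun a b h => h2 (Nat.succ_lt_succ h))).1 ?_
    ext m
    cases m with
    | zero =>
      refine iff_of_false ?_ ?_
      · rintro ⟨k, hk⟩
        have := h1 (Nat.succ_pos k)
        simp only [Finset.range_zero, Finset.sum_empty] at this hk
        simp only [Nat.succ_eq_add_one] at this
        exact absurd hk this.ne'
      · rintro ⟨k, hk⟩
        have := h2 (Nat.succ_pos k)
        simp only [Finset.range_zero, Finset.sum_empty] at this hk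
        simp only [Nat.succ_eq_add_one] at this
        exact absurd hk this.ne'
    | succ n => exact (hx.mem_iff hβ n).symm.trans (hy.mem_iff hγ n)
  have key' : ∀ k, ∑ j ∈ Finset.range k, (β j).edges.length =
      ∑ j ∈ Finset.range k, (γ j).edges.length := by
    intro k
    cases k with
    | zero => simp
    | succ k => exact congrFun key k
  funext k
  have hlen : (β k).edges.length = (γ k).edges.length := by
    have a := key' (k + 1)
    rw [Finset.sum_range_succ, Finset.sum_range_succ, key' k] at a
    omega
  have hed : (β k).edges = (γ k).edges := by
    apply List.ext_getElem hlen
    intro i ha hb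
    have a := hx k i ha
    rw [key' k, hy k i hb] at a
    exact a.symm
  cases hb : β k
  cases hc : γ k
  rw [hb, hc] at hed
  simp only at hed
  subst hed
  rfl

/-- The finite path made of the edges `x a, ..., x (b - 1)`. -/
def cutSeg (x : ℕ → E) (hx : ∀ i, s (x i) = r (x (i + 1))) (a b : ℕ) (h : a < b) :
    GraphSeg V E r s where
  edges := List.ofFn fun i : Fin (b - a) => x (a + i)
  ne := by
    intro h0
    have := congrArg List.length h0
    simp at this
    omega
  chain := by
    apply List.isChain_iff_getElem.2
    intro i hi
    simp only [List.getElem_ofFn]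
    exact hx _

theorem exists_segments {F0 : Set V} (x : ℕ → E) (hx : ∀ i, s (x i) = r (x (i + 1)))
    (h0 : r (x 0) ∈ F0) (hinf : {i | s (x i) ∈ F0}.Infinite) :
    ∃ β : ℕ → GraphSeg V E r s, ((∀ k, IsFSegment F0 (β k)) ∧
      ∀ k, (β k).src = (β (k + 1)).rng) ∧ IsConcat β x := by
  classical
  obtain ⟨t, ht0, htm, htF, htn⟩ : ∃ t : ℕ → ℕ, t 0 = 0 ∧ (∀ k, t k < t (k + 1)) ∧
      (∀ k, s (x (t (k + 1) - 1)) ∈ F0) ∧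
      (∀ k i, t k ≤ i → i + 1 < t (k + 1) → s (x i) ∉ F0) := by
    refine ⟨fun k => Nat.casesOn k 0 fun k => Nat.nth (fun i => s (x i) ∈ F0) k + 1,
      rfl, ?_, ?_, ?_⟩
    · intro k
      cases k with
      | zero => exact Nat.succ_pos _
      | succ k => exact Nat.succ_lt_succ (Nat.nth_strictMono hinf (Nat.lt_succ_self k))
    · intro k
      exact Nat.nth_mem_of_infinite hinf k
    · intro k i h1 h2 h3
      have h2' := Nat.lt_of_succ_lt_succ h2
      have h4 : i ∈ Set.range (Nat.nth fun i => s (x i) ∈ F0) := by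
        rw [Nat.range_nth_of_infinite hinf]
        exact h3
      obtain ⟨m, rfl⟩ := h4
      have hm := (Nat.nth_lt_nth hinf).1 h2'
      cases k with
      | zero => omega
      | succ k =>
        have := (Nat.nth_lt_nth hinf).1 (Nat.lt_of_succ_le h1)
        omega
  let β : ℕ → GraphSeg V E r s := fun k => cutSeg x hx (t k) (t (k + 1)) (htm k)
  have hlen : ∀ k, (β k).edges.length = t (k + 1) - t k := fun k => by simp [β, cutSeg]
  have hsum : ∀ k, ∑ j ∈ Finset.range k, (β j).edges.length = t k := by
    intro k
    induction k with
    | zero => simp [ht0]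
    | succ k ih =>
      have := htm k
      rw [Finset.sum_range_succ, ih, hlen]
      omega
  have hc : IsConcat β x := by
    intro k i hi
    rw [hsum]
    simp [β, cutSeg]
  have hr : ∀ k, (β k).rng = r (x (t k)) := fun k => by rw [← hc.first, hsum]
  have hs : ∀ k, (β k).src = s (x (t (k + 1) - 1)) := fun k => by
    have := htm k
    rw [← hc.last (i := t (k + 1) - t k - 1) (by rw [hlen]; omega), hsum]
    congr 2
    omega
  have hsr : ∀ k, (β k).src = (β (k + 1)).rng := fun k => by
    have := htm k
    rw [hs, hr, hx]
    congr 2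
    omega
  refine ⟨β, ⟨fun k => ⟨?_, ?_, ?_⟩, hsr⟩, hc⟩
  · cases k with
    | zero => rw [hr, ht0]; exact h0
    | succ k => rw [← hsr, hs]; exact htF k
  · rw [hs]; exact htF k
  · intro i h
    rw [← hc k i, hsum]
    rw [hlen] at h
    exact htn k _ (by omega) (by omega)

end

/-- The concatenation map `(βⁱ)ᵢ ↦ β¹β²β³⋯` is a bijection from the
set of infinite sequences of `F`-segments with `s_E(βⁱ) = r_E(βⁱ⁺¹)` onto the set of
infinite paths `x ∈ E^∞` with `r_E(x) ∈ F⁰` and `s_E(xᵢ) ∈ F⁰` for infinitely many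
`i`. -/
theorem concat_bijection_FSegments
    {V E : Type*} (r s : E → V) (F0 : Set V) :
    ∃ Φ : {β : ℕ → GraphSeg V E r s //
            (∀ k, IsFSegment F0 (β k)) ∧ ∀ k, (β k).src = (β (k + 1)).rng} →
          {x : ℕ → E //
            (∀ i, s (x i) = r (x (i + 1))) ∧ r (x 0) ∈ F0 ∧
              {i | s (x i) ∈ F0}.Infinite},
      (∀ β, IsConcat β.1 (Φ β).1) ∧ Function.Bijective Φ := by
  have key : ∀ β : {β : ℕ → GraphSeg V E r s //
      (∀ k, IsFSegment F0 (β k)) ∧ ∀ k, (β k).src = (β (k + 1)).rng},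
      ∃ x : {x : ℕ → E // (∀ i, s (x i) = r (x (i + 1))) ∧ r (x 0) ∈ F0 ∧
        {i | s (x i) ∈ F0}.Infinite}, IsConcat β.1 x.1 := by
    rintro ⟨β, hF, hsr⟩
    obtain ⟨x, hx⟩ := exists_isConcat β
    refine ⟨⟨x, hx.path hsr, ?_, ?_⟩, hx⟩
    · have := hx.first 0
      rw [Finset.range_zero, Finset.sum_empty] at this
      rw [this]
      exact (hF 0).1
    · apply Set.infinite_of_not_bddAbove
      rintro ⟨b, hb⟩
      have hm := (offs_strictMono _ fun k => (β k).len_pos)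
      have h1 := hm.le_apply (x := b + 1 + 1)
      obtain ⟨n, hn⟩ : ∃ n, ∑ j ∈ Finset.range (b + 1 + 1), (β j).edges.length = n + 1 :=
        Nat.exists_eq_succ_of_ne_zero (by omega)
      have := hb (show n ∈ {i | s (x i) ∈ F0} from (hx.mem_iff hF n).2 ⟨_, hn⟩)
      omega
  choose Φ hΦ using key
  refine ⟨Φ, hΦ, ?_, ?_⟩
  · intro β γ h
    have h2 := hΦ γ
    rw [← h] at h2
    exact Subtype.ext ((hΦ β).inj β.2.1 h2 γ.2.1)
  · rintro ⟨x, hx, h0, hinf⟩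
    obtain ⟨β, hβ, hc⟩ := exists_segments x hx h0 hinf
    exact ⟨⟨β, hβ⟩, Subtype.ext ((hΦ ⟨β, hβ⟩).unique hc)⟩
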